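/- arXiv:2411.15722 — 3 statements merged into one kernel-verified Lean document; each statement's English description precedes it below -/
import Mathlib

section
/- Let R > 0 and let u : ℝ → ℝ be continuously differentiable on the closed interval [0, R]. Then u(R)^2 ≤ (8/R^3) ∫_0^R r^2 u(r)^2 dr + (8/R^2) (∫_0^R r^2 u(r)^2 dr)^{1/2} (∫_0^R r^2 u'(r)^2 dr)^{1/2}. -/
open MeasureTheory intervalIntegral

/-- Explicit-constant weighted trace inequality: for `u` continuously differentiable
on `[0, R]` (with derivative `u'`),
`u(R)^2 ≤ (8/R^3)∫_0^R r^2 u^2 + (8/R^2)(∫_0^R r^2 u^2)^{1/2}(∫_0^R r^2 u'^2)^{1/2}`. -/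
theorem stmt_1 (R : ℝ) (hR : 0 < R) (u u' : ℝ → ℝ)
    (hu : ∀ r ∈ Set.Icc (0 : ℝ) R, HasDerivWithinAt u (u' r) (Set.Icc (0 : ℝ) R) r)
    (hu' : ContinuousOn u' (Set.Icc (0 : ℝ) R)) :
    u R ^ 2 ≤ (8 / R ^ 3) * (∫ r in (0 : ℝ)..R, r ^ 2 * u r ^ 2)
      + (8 / R ^ 2) * Real.sqrt (∫ r in (0 : ℝ)..R, r ^ 2 * u r ^ 2)
          * Real.sqrt (∫ r in (0 : ℝ)..R, r ^ 2 * u' r ^ 2) := by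
  have hle : (0:ℝ) ≤ R := hR.le
  have hI : Set.uIcc (0:ℝ) R = Set.Icc 0 R := Set.uIcc_of_le hle
  have huc : ContinuousOn u (Set.Icc (0 : ℝ) R) := fun r hr => (hu r hr).continuousWithinAt
  have ii : ∀ f : ℝ → ℝ, ContinuousOn f (Set.Icc (0:ℝ) R) → IntervalIntegrable f volume 0 R :=
    fun f hf => ContinuousOn.intervalIntegrable (by rwa [hI])
  have iA := ii (fun r => r ^ 2 * u r ^ 2) (by fun_prop)
  have iB := ii (fun r => r ^ 2 * u' r ^ 2) (by fun_prop)
  have iC := ii (fun r => r ^ 3 * u r * u' r) (by fun_prop)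
  have iD := ii (fun r => r ^ 4 * u' r ^ 2) (by fun_prop)
  set A := ∫ r in (0 : ℝ)..R, r ^ 2 * u r ^ 2 with hA
  set B := ∫ r in (0 : ℝ)..R, r ^ 2 * u' r ^ 2 with hB
  set C := ∫ r in (0 : ℝ)..R, r ^ 3 * u r * u' r with hC
  set D := ∫ r in (0 : ℝ)..R, r ^ 4 * u' r ^ 2 with hD
  have hA0 : 0 ≤ A := integral_nonneg hle (fun r _ => by positivity)
  have hB0 : 0 ≤ B := integral_nonneg hle (fun r _ => by positivity)
  have hDB : D ≤ R ^ 2 * B := by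
    rw [hD, hB, ← intervalIntegral.integral_const_mul]
    refine integral_mono_on hle iD (iB.const_mul _) (fun r hr => ?_)
    have h1 : r ^ 2 ≤ R ^ 2 := pow_le_pow_left₀ hr.1 hr.2 2
    have h2 : 0 ≤ r ^ 2 * u' r ^ 2 := by positivity
    nlinarith [mul_le_mul_of_nonneg_right h1 h2]
  have hq : ∀ t : ℝ, 0 ≤ A * (t * t) + (2 * C) * t + D := by
    intro t
    have h : ∫ r in (0 : ℝ)..R, (t * (r * u r) + r ^ 2 * u' r) ^ 2
        = (t * t) * A + (2 * t) * C + D := by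
      rw [hA, hC, hD, ← intervalIntegral.integral_const_mul,
        ← intervalIntegral.integral_const_mul,
        ← intervalIntegral.integral_add (iA.const_mul _) (iC.const_mul _),
        ← intervalIntegral.integral_add ((iA.const_mul _).add (iC.const_mul _)) iD]
      congr 1
      ext r
      ring
    have h0 : 0 ≤ ∫ r in (0 : ℝ)..R, (t * (r * u r) + r ^ 2 * u' r) ^ 2 :=
      integral_nonneg hle (fun r _ => by positivity)
    linarith
  have hdisc := discrim_le_zero hq
  have hC2 : C ≤ R * (Real.sqrt A * Real.sqrt B) := by
    refine le_of_abs_le (abs_le_of_sq_le_sq ?_ (by positivity))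
    rw [mul_pow, mul_pow, Real.sq_sqrt hA0, Real.sq_sqrt hB0]
    have := mul_le_mul_of_nonneg_left hDB hA0
    unfold discrim at hdisc
    nlinarith
  have hftc : R ^ 3 * u R ^ 2 = 3 * A + 2 * C := by
    have h := integral_eq_sub_of_hasDerivAt_of_le hle
      (f := fun r => r ^ 3 * u r ^ 2)
      (f' := fun r => 3 * (r ^ 2 * u r ^ 2) + 2 * (r ^ 3 * u r * u' r)) (by fun_prop)
      (fun r hr => by
        have h1 := (hu r (Set.Ioo_subset_Icc_self hr)).hasDerivAt (Icc_mem_nhds hr.1 hr.2)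
        refine ((hasDerivAt_pow 3 r).mul (h1.pow 2)).congr_deriv ?_
        simp only [Pi.pow_apply]
        push_cast
        ring)
      ((iA.const_mul _).add (iC.const_mul _))
    rw [intervalIntegral.integral_add (iA.const_mul _) (iC.const_mul _),
      intervalIntegral.integral_const_mul, intervalIntegral.integral_const_mul] at h
    simp only [← hA, ← hC] at h
    linarith
  have hS : 0 ≤ Real.sqrt A * Real.sqrt B := by positivity
  have e : (8 / R ^ 3) * A + (8 / R ^ 2) * Real.sqrt A * Real.sqrt B
      = (8 * A + 8 * (R * (Real.sqrt A * Real.sqrt B))) / R ^ 3 := by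
    field_simp
  rw [e, le_div_iff₀ (by positivity)]
  have := mul_nonneg hle hS
  linarith
end

section
/- Let R > 0. For every ε > 0 there exists a positive constant C (depending only on ε and R) such that for every u : ℝ → ℝ continuously differentiable on [0, R], |u(R)| ≤ ε (∫_0^R r^2 u'(r)^2 dr)^{1/2} + C (∫_0^R r^2 u(r)^2 dr)^{1/2}. -/
open MeasureTheory intervalIntegral

/-- Radial trace estimate (Proposition A.1): for every `ε > 0` there is `C > 0`
(depending only on `ε` and `R`) such that for every `u` continuously differentiable
on `[0, R]` (with derivative `u'`),
`|u(R)| ≤ ε (∫_0^R r^2 u'^2)^{1/2} + C (∫_0^R r^2 u^2)^{1/2}`. -/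
theorem stmt_2 (R : ℝ) (hR : 0 < R) :
    ∀ ε > (0 : ℝ), ∃ C > (0 : ℝ), ∀ u u' : ℝ → ℝ,
      (∀ r ∈ Set.Icc (0 : ℝ) R, HasDerivWithinAt u (u' r) (Set.Icc (0 : ℝ) R) r) →
      ContinuousOn u' (Set.Icc (0 : ℝ) R) →
      |u R| ≤ ε * Real.sqrt (∫ r in (0 : ℝ)..R, r ^ 2 * u' r ^ 2)
        + C * Real.sqrt (∫ r in (0 : ℝ)..R, r ^ 2 * u r ^ 2) := by
  intro ε hε
  have hK : 0 < (3 + 1 / (R * ε ^ 2)) / R ^ 3 := by positivity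
  refine ⟨Real.sqrt ((3 + 1 / (R * ε ^ 2)) / R ^ 3), Real.sqrt_pos.2 hK, ?_⟩
  intro u u' hu hu'
  have huc : ContinuousOn u (Set.Icc 0 R) := fun r hr => (hu r hr).continuousWithinAt
  have hle : (0 : ℝ) ≤ R := hR.le
  have hA : IntervalIntegrable (fun r => r ^ 2 * u' r ^ 2) volume 0 R := by
    apply ContinuousOn.intervalIntegrable_of_Icc hle
    fun_prop
  have hB : IntervalIntegrable (fun r => r ^ 2 * u r ^ 2) volume 0 R := by
    apply ContinuousOn.intervalIntegrable_of_Icc hle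
    fun_prop
  have hD : IntervalIntegrable
      (fun r => 3 * r ^ 2 * u r ^ 2 + r ^ 3 * (2 * u r * u' r)) volume 0 R := by
    apply ContinuousOn.intervalIntegrable_of_Icc hle
    fun_prop
  have hftc : ∫ r in (0 : ℝ)..R, (3 * r ^ 2 * u r ^ 2 + r ^ 3 * (2 * u r * u' r))
      = R ^ 3 * u R ^ 2 - 0 ^ 3 * u 0 ^ 2 := by
    refine integral_eq_sub_of_hasDerivAt_of_le (f := fun r => r ^ 3 * u r ^ 2) hle
      (by fun_prop) ?_ hD
    intro r hr
    have h1 : HasDerivAt u (u' r) r :=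
      (hu r ⟨hr.1.le, hr.2.le⟩).hasDerivAt (Icc_mem_nhds hr.1 hr.2)
    have h2 := (hasDerivAt_pow 3 r).mul (h1.pow 2)
    refine h2.congr_deriv ?_
    simp
  have hA0 : 0 ≤ ∫ r in (0 : ℝ)..R, r ^ 2 * u' r ^ 2 :=
    integral_nonneg hle fun r _ => by positivity
  have hB0 : 0 ≤ ∫ r in (0 : ℝ)..R, r ^ 2 * u r ^ 2 :=
    integral_nonneg hle fun r _ => by positivity
  have hmono : ∫ r in (0 : ℝ)..R, (3 * r ^ 2 * u r ^ 2 + r ^ 3 * (2 * u r * u' r))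
      ≤ ∫ r in (0 : ℝ)..R, ((R ^ 3 * ε ^ 2) * (r ^ 2 * u' r ^ 2)
        + (3 + 1 / (R * ε ^ 2)) * (r ^ 2 * u r ^ 2)) := by
    refine integral_mono_on hle hD ((hA.const_mul _).add (hB.const_mul _)) ?_
    intro r hr
    have hr2 : r ^ 2 ≤ R ^ 2 := pow_le_pow_left₀ hr.1 hr.2 2
    have key : 2 * r * u r * u' r
        ≤ R ^ 3 * ε ^ 2 * u' r ^ 2 + 1 / (R * ε ^ 2) * u r ^ 2 := by
      have hpos : 0 < R ^ 3 * ε ^ 2 := by positivity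
      have e1 : 1 / (R * ε ^ 2) * u r ^ 2 = R ^ 2 * u r ^ 2 / (R ^ 3 * ε ^ 2) := by
        field_simp
      have e2 : r ^ 2 * u r ^ 2 / (R ^ 3 * ε ^ 2) ≤ R ^ 2 * u r ^ 2 / (R ^ 3 * ε ^ 2) := by
        gcongr
      have e3 : R ^ 3 * ε ^ 2 * u' r ^ 2 + r ^ 2 * u r ^ 2 / (R ^ 3 * ε ^ 2)
          - 2 * r * u r * u' r
          = (R ^ 3 * ε ^ 2 * u' r - r * u r) ^ 2 / (R ^ 3 * ε ^ 2) := by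
        field_simp
        ring
      have e4 : 0 ≤ (R ^ 3 * ε ^ 2 * u' r - r * u r) ^ 2 / (R ^ 3 * ε ^ 2) := by positivity
      linarith
    have := mul_le_mul_of_nonneg_left key (sq_nonneg r)
    linarith
  rw [hftc, integral_add (hA.const_mul _) (hB.const_mul _), intervalIntegral.integral_const_mul,
    intervalIntegral.integral_const_mul] at hmono
  set A := ∫ r in (0 : ℝ)..R, r ^ 2 * u' r ^ 2
  set B := ∫ r in (0 : ℝ)..R, r ^ 2 * u r ^ 2
  set L := 3 + 1 / (R * ε ^ 2)
  have hsq : u R ^ 2 ≤ ε ^ 2 * A + L / R ^ 3 * B := by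
    have h3 : 0 < R ^ 3 := by positivity
    have e : R ^ 3 * (ε ^ 2 * A + L / R ^ 3 * B) = R ^ 3 * ε ^ 2 * A + L * B := by
      field_simp
    refine le_of_mul_le_mul_left ?_ h3
    linarith
  have hsum : 0 ≤ ε * Real.sqrt A + Real.sqrt (L / R ^ 3) * Real.sqrt B := by positivity
  refine abs_le_of_sq_le_sq ?_ hsum
  have s1 := Real.sq_sqrt hA0
  have s2 := Real.sq_sqrt hB0
  have s3 := Real.sq_sqrt hK.le
  have hc : 0 ≤ 2 * (ε * Real.sqrt A) * (Real.sqrt (L / R ^ 3) * Real.sqrt B) := by positivity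
  rw [add_sq, mul_pow, mul_pow, s1, s2, s3]
  linarith
end

section
/- Let R > 0. For every ε > 0 there exists a positive constant C (depending only on ε and R) such that for every u : ℝ → ℝ continuously differentiable on [0, R], u(R)^2 ≤ ε ∫_0^R r^2 u'(r)^2 dr + C ∫_0^R r^2 u(r)^2 dr. -/
open MeasureTheory intervalIntegral

/-- Squared radial trace estimate used in the energy estimate for the particle
concentration error: for every `ε > 0` there is `C > 0` (depending only on `ε` and `R`)
such that for every `u` continuously differentiable on `[0, R]` (with derivative `u'`),
`u(R)^2 ≤ ε ∫_0^R r^2 u'^2 + C ∫_0^R r^2 u^2`. -/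
theorem stmt_3 (R : ℝ) (hR : 0 < R) :
    ∀ ε > (0 : ℝ), ∃ C > (0 : ℝ), ∀ u u' : ℝ → ℝ,
      (∀ r ∈ Set.Icc (0 : ℝ) R, HasDerivWithinAt u (u' r) (Set.Icc (0 : ℝ) R) r) →
      ContinuousOn u' (Set.Icc (0 : ℝ) R) →
      u R ^ 2 ≤ ε * (∫ r in (0 : ℝ)..R, r ^ 2 * u' r ^ 2)
        + C * (∫ r in (0 : ℝ)..R, r ^ 2 * u r ^ 2) := by
  intro ε hε
  refine ⟨(4 * R + 1 / ε) / R ^ 4, by positivity, ?_⟩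
  intro u u' hu hu'
  have huc : ContinuousOn u (Set.Icc (0 : ℝ) R) := fun r hr => (hu r hr).continuousWithinAt
  have hI : Set.uIcc (0 : ℝ) R = Set.Icc 0 R := Set.uIcc_of_le hR.le
  have hint : ∀ f : ℝ → ℝ, ContinuousOn f (Set.Icc (0 : ℝ) R) →
      IntervalIntegrable f volume 0 R := fun f hf =>
    ContinuousOn.intervalIntegrable (by rwa [hI])
  have hg : ContinuousOn (fun r => 4 * r ^ 3 * u r ^ 2 + r ^ 4 * (2 * u r * u' r))
      (Set.Icc (0 : ℝ) R) := by fun_prop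
  have h1 : ContinuousOn (fun r => r ^ 2 * u' r ^ 2) (Set.Icc (0 : ℝ) R) := by fun_prop
  have h2 : ContinuousOn (fun r => r ^ 2 * u r ^ 2) (Set.Icc (0 : ℝ) R) := by fun_prop
  have hftc : ∫ r in (0 : ℝ)..R, (4 * r ^ 3 * u r ^ 2 + r ^ 4 * (2 * u r * u' r))
      = R ^ 4 * u R ^ 2 - 0 ^ 4 * u 0 ^ 2 := by
    refine intervalIntegral.integral_eq_sub_of_hasDerivAt_of_le
      (f := fun r => r ^ 4 * u r ^ 2) hR.le (by fun_prop) ?_ (hint _ hg)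
    intro r hr
    have hd := (hu r (Set.Ioo_subset_Icc_self hr)).hasDerivAt (Icc_mem_nhds hr.1 hr.2)
    have := (hasDerivAt_pow 4 r).mul (hd.pow 2)
    refine this.congr_deriv ?_
    simp
  have hmono : ∫ r in (0 : ℝ)..R, (4 * r ^ 3 * u r ^ 2 + r ^ 4 * (2 * u r * u' r))
      ≤ ∫ r in (0 : ℝ)..R, ((ε * R ^ 4) * (r ^ 2 * u' r ^ 2)
        + (4 * R + 1 / ε) * (r ^ 2 * u r ^ 2)) := by
    refine intervalIntegral.integral_mono_on hR.le (hint _ hg) (hint _ (by fun_prop)) ?_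
    intro r hr
    obtain ⟨h0, hrR⟩ := hr
    have a1 : 4 * r ^ 3 * u r ^ 2 ≤ 4 * R * (r ^ 2 * u r ^ 2) := by
      have : 0 ≤ (R - r) * (r ^ 2 * u r ^ 2) := mul_nonneg (by linarith) (by positivity)
      nlinarith
    have a2 : r ^ 4 ≤ R ^ 4 := pow_le_pow_left₀ h0 hrR 4
    have a4 : r ^ 4 * (2 * u r * u' r)
        ≤ (ε * R ^ 4) * (r ^ 2 * u' r ^ 2) + 1 / ε * (r ^ 2 * u r ^ 2) := by
      have e : (ε * R ^ 4) * (r ^ 2 * u' r ^ 2) + 1 / ε * (r ^ 2 * u r ^ 2)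
          - r ^ 4 * (2 * u r * u' r)
          = r ^ 2 * (ε * u' r ^ 2 * (R ^ 4 - r ^ 4) + ε * (r ^ 2 * u' r - u r / ε) ^ 2) := by
        field_simp; ring
      have : 0 ≤ r ^ 2 * (ε * u' r ^ 2 * (R ^ 4 - r ^ 4)
          + ε * (r ^ 2 * u' r - u r / ε) ^ 2) := by
        have : 0 ≤ R ^ 4 - r ^ 4 := by linarith
        positivity
      linarith
    linarith
  rw [hftc, intervalIntegral.integral_add ((hint _ h1).const_mul _) ((hint _ h2).const_mul _),
    intervalIntegral.integral_const_mul, intervalIntegral.integral_const_mul] at hmono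
  have hR4 : 0 < R ^ 4 := by positivity
  refine le_of_mul_le_mul_left ?_ hR4
  refine le_trans (by linarith) (hmono.trans (le_of_eq ?_))
  field_simp
end
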